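/- arXiv:1708.06815 — 2 statements merged into one kernel-verified Lean document; each statement's English description precedes it below -/
import Mathlib

section
/- Let G be a loopless graph whose edge set is partitioned into blocks by a map π : E → Fin m, and let c : Fin m → K be elements that are algebraically independent over ℚ ('generic parameters'). Set q_e = c(π e) for every edge e. Then dim_K Ψ_{G,Q} = ∏_{i ∈ Fin m} #{F ⊆ π^{-1}(i) : F is a forest of G}, i.e., the dimension equals the number of m-tuples (F_1, …, F_m) of forests of G with F_i contained in the i-th block. -/
open MvPolynomial

set_option synthInstance.maxHeartbeats 1000000
set_option maxHeartbeats 1000000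

noncomputable section

/-- The ideal of relations `u_e ^ 2 = q_e * u_e`. -/
def relIdeal (K : Type*) [Field K] (E : Type*) (q : E → K) :
    Ideal (MvPolynomial E K) :=
  Ideal.span (Set.range fun e : E => (X e) ^ 2 - C (q e) * X e)

/-- The algebra `Φ_{G,Q}`. -/
abbrev PhiAlg (K : Type*) [Field K] (E : Type*) (q : E → K) : Type _ :=
  MvPolynomial E K ⧸ relIdeal K E q

/-- The generator `X_i` of the `Q`-deformation. -/
def XX (K : Type*) [Field K] {n : ℕ} {E : Type*} [Fintype E]
    (a b : E → Fin n) (q : E → K) (i : Fin n) : PhiAlg K E q :=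
  Ideal.Quotient.mk _
    ((∑ e ∈ Finset.univ.filter fun e => a e = i, X e) -
      ∑ e ∈ Finset.univ.filter fun e => b e = i, X e)

/-- The `Q`-deformation `Ψ_{G,Q}` of the Postnikov–Shapiro algebra. -/
def PsiAlg (K : Type*) [Field K] {n : ℕ} {E : Type*} [Fintype E]
    (a b : E → Fin n) (q : E → K) : Subalgebra K (PhiAlg K E q) :=
  Algebra.adjoin K (Set.range (XX K a b q))

/-- The vector `χ_{a e} - χ_{b e}` in `ℚ^n` associated to an edge. -/
def edgeVec {n : ℕ} {E : Type*} (a b : E → Fin n) (e : E) : Fin n → ℚ :=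
  fun i => (if a e = i then 1 else 0) - (if b e = i then 1 else 0)

/-- A subset of the edges is a forest if the associated vectors are linearly independent. -/
def IsForest {n : ℕ} {E : Type*} (a b : E → Fin n) (F : Finset E) : Prop :=
  LinearIndependent ℚ fun e : F => edgeVec a b (e : E)

lemma edgeVec_apply {n : ℕ} {E : Type*} (a b : E → Fin n) (e : E) (i : Fin n) :
    edgeVec a b e i = (if a e = i then 1 else 0) - (if b e = i then 1 else 0) := rfl

/-- Extraction of a path from a flow. -/
lemma exists_subflow {n : ℕ} {E : Type*} [DecidableEq E] (a b : E → Fin n) (t : Fin n) :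
    ∀ (N : ℕ) (D : Finset E) (s : Fin n), D.card = N →
      (∀ x, x ≠ t → 0 ≤ (∑ e ∈ D, edgeVec a b e) x) →
      (s = t ∨ 0 < (∑ e ∈ D, edgeVec a b e) s) →
      ∃ D' ⊆ D, ∀ x, (∑ e ∈ D', edgeVec a b e) x =
        (if s = x then 1 else 0) - (if t = x then 1 else 0) := by
  intro N
  induction N with
  | zero =>
    intro D s hD _ hs
    rw [Finset.card_eq_zero] at hD
    subst hD
    rcases hs with rfl | hs
    · exact ⟨∅, by simp, by simp⟩
    · simp at hs
  | succ N ih =>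
    intro D s hD hx hs
    by_cases hst : s = t
    · subst hst
      exact ⟨∅, by simp, by simp⟩
    have hs : 0 < (∑ e ∈ D, edgeVec a b e) s := by tauto
    obtain ⟨g, hg, hgs⟩ : ∃ g ∈ D, 0 < edgeVec a b g s := by
      by_contra! h
      rw [Finset.sum_apply] at hs
      exact absurd (Finset.sum_nonpos h) (not_le.mpr hs)
    have has : a g = s := by
      by_contra h
      rw [edgeVec_apply, if_neg h] at hgs
      split_ifs at hgs <;> norm_num at hgs
    have hbs : b g ≠ s := by
      intro h
      rw [edgeVec_apply, if_pos has, if_pos h] at hgs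
      norm_num at hgs
    have hsum : ∀ x, (∑ e ∈ D.erase g, edgeVec a b e) x
        = (∑ e ∈ D, edgeVec a b e) x - edgeVec a b g x := by
      intro x
      rw [← Finset.add_sum_erase D _ hg]
      simp
    have hint : 1 ≤ (∑ e ∈ D, edgeVec a b e) s := by
      have : ∃ z : ℤ, (∑ e ∈ D, edgeVec a b e) s = z := by
        refine ⟨∑ e ∈ D, ((if a e = s then 1 else 0) - (if b e = s then 1 else 0)), ?_⟩
        rw [Finset.sum_apply]
        push_cast
        rfl
      obtain ⟨z, hz⟩ := this
      rw [hz] at hs ⊢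
      have : 0 < z := by exact_mod_cast hs
      exact_mod_cast this
    obtain ⟨D', hD', h'⟩ := ih (D.erase g) (b g) (by rw [Finset.card_erase_of_mem hg, hD]; rfl)
      (by
        intro x hxt
        rw [hsum, edgeVec_apply, has]
        have := hx x hxt
        by_cases h1 : s = x
        · subst h1
          simp only [if_true]
          rw [if_neg hbs]
          linarith
        · rw [if_neg h1]
          split_ifs <;> linarith)
      (by
        by_cases hbt : b g = t
        · exact Or.inl hbt
        · right
          rw [hsum, edgeVec_apply, has, if_neg (Ne.symm hbs), if_pos rfl]
          have := hx _ hbt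
          linarith)
    have hgD' : g ∉ D' := fun h => by simpa using hD' h
    refine ⟨insert g D', ?_, ?_⟩
    · intro x hx
      rw [Finset.mem_insert] at hx
      rcases hx with rfl | hx
      · exact hg
      · exact Finset.mem_of_mem_erase (hD' hx)
    · intro x
      rw [Finset.sum_insert hgD', Pi.add_apply, h', edgeVec_apply, has]
      ring

/-- The set of subset sums. -/
def subSums {n : ℕ} {E : Type*} (a b : E → Fin n) (T : Finset E) : Finset (Fin n → ℚ) :=
  T.powerset.image fun S => ∑ e ∈ S, edgeVec a b e

open Classical in
/-- The forests contained in a set of edges. -/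
def forestsIn {n : ℕ} {E : Type*} (a b : E → Fin n) (T : Finset E) : Finset (Finset E) :=
  T.powerset.filter (IsForest a b)

lemma mem_subSums {n : ℕ} {E : Type*} {a b : E → Fin n} {T : Finset E} {z : Fin n → ℚ} :
    z ∈ subSums a b T ↔ ∃ S ⊆ T, ∑ e ∈ S, edgeVec a b e = z := by
  simp [subSums]

/-- Subset sums have no holes in the direction of an edge. -/
lemma subSums_step {n : ℕ} {E : Type*} [DecidableEq E] (a b : E → Fin n) (T : Finset E) (e : E)
    (he : a e ≠ b e) (z : Fin n → ℚ) (k : ℚ) (hk : 0 < k) (hz : z ∈ subSums a b T)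
    (hz' : z + k • edgeVec a b e ∈ subSums a b T) : z + edgeVec a b e ∈ subSums a b T := by
  rw [mem_subSums] at *
  obtain ⟨S, hS, rfl⟩ := hz
  obtain ⟨S', hS', h⟩ := hz'
  let a' : E → Fin n := fun f => if f ∈ S then b f else a f
  let b' : E → Fin n := fun f => if f ∈ S then a f else b f
  have hin : ∀ f ∈ S, edgeVec a' b' f = - edgeVec a b f := by
    intro f hf
    ext i
    simp [edgeVec_apply, a', b', hf]
  have hout : ∀ f ∉ S, edgeVec a' b' f = edgeVec a b f := by
    intro f hf
    ext i
    simp [edgeVec_apply, a', b', hf]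
  have key : ∀ D : Finset E, ∑ f ∈ S, edgeVec a b f + ∑ f ∈ D, edgeVec a' b' f
      = ∑ f ∈ (S \ D) ∪ (D \ S), edgeVec a b f := by
    intro D
    rw [Finset.sum_union (by
      rw [Finset.disjoint_left]; intro x hx hx'
      simp only [Finset.mem_sdiff] at hx hx'; tauto)]
    rw [← Finset.sum_inter_add_sum_sdiff D S]
    rw [← Finset.sum_inter_add_sum_sdiff S D (edgeVec a b)]
    rw [Finset.sum_congr rfl (fun f hf => hout f (Finset.mem_sdiff.mp hf).2),
      Finset.sum_congr (s₁ := D ∩ S) rfl (fun f hf => hin f (Finset.mem_inter.mp hf).2),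
      Finset.sum_neg_distrib, Finset.inter_comm D S]
    abel
  have hd : ∑ f ∈ (S \ S') ∪ (S' \ S), edgeVec a' b' f = k • edgeVec a b e := by
    have := key ((S \ S') ∪ (S' \ S))
    have h2 : (S \ ((S \ S') ∪ (S' \ S))) ∪ (((S \ S') ∪ (S' \ S)) \ S) = S' := by
      ext x; simp only [Finset.mem_union, Finset.mem_sdiff]; tauto
    rw [h2, h] at this
    exact add_left_cancel this
  obtain ⟨D', hD', hflow⟩ := exists_subflow a' b' (b e) _ ((S \ S') ∪ (S' \ S)) (a e) rfl
    (by
      intro x hx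
      rw [hd, Pi.smul_apply, edgeVec_apply, if_neg (Ne.symm hx)]
      split_ifs <;> simp [hk.le])
    (by
      right
      rw [hd, Pi.smul_apply, edgeVec_apply, if_neg (Ne.symm he)]
      simp [hk])
  refine ⟨(S \ D') ∪ (D' \ S), ?_, ?_⟩
  · intro x hx
    simp only [Finset.mem_union, Finset.mem_sdiff] at hx
    rcases hx with hx | hx
    · exact hS hx.1
    · have := hD' hx.1
      simp only [Finset.mem_union, Finset.mem_sdiff] at this
      rcases this with h | h
      · exact hS h.1
      · exact hS' h.1
  · rw [← key D']
    congr 1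
    ext x
    rw [hflow, edgeVec_apply]

/-- The contraction map. -/
def contr {n : ℕ} (v : Fin n → ℚ) (t : Fin n) : (Fin n → ℚ) →ₗ[ℚ] (Fin n → ℚ) :=
  LinearMap.id + (LinearMap.proj t : (Fin n → ℚ) →ₗ[ℚ] ℚ).smulRight v

lemma contr_apply {n : ℕ} (v : Fin n → ℚ) (t : Fin n) (x : Fin n → ℚ) :
    contr v t x = x + x t • v := by
  simp [contr]

lemma contr_edgeVec {n : ℕ} {E : Type*} (a b : E → Fin n) (e f : E) (he : a e ≠ b e) :
    contr (edgeVec a b e) (b e) (edgeVec a b f) =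
      edgeVec (fun g => if a g = b e then a e else a g)
        (fun g => if b g = b e then a e else b g) f := by
  rw [contr_apply]
  ext i
  simp only [Pi.add_apply, Pi.smul_apply, edgeVec_apply, smul_eq_mul]
  by_cases h1 : a f = b e <;> by_cases h2 : b f = b e <;> by_cases h3 : b e = i <;>
    by_cases h4 : a e = i <;> simp [h1, h2, h3, h4] <;> grind

lemma ker_contr {n : ℕ} {E : Type*} (a b : E → Fin n) (e : E) (he : a e ≠ b e) :
    LinearMap.ker (contr (edgeVec a b e) (b e)) = Submodule.span ℚ {edgeVec a b e} := by
  ext x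
  rw [LinearMap.mem_ker, contr_apply, Submodule.mem_span_singleton]
  constructor
  · intro h
    refine ⟨- x (b e), ?_⟩
    rw [neg_smul]
    exact (eq_neg_of_add_eq_zero_left h).symm
  · rintro ⟨k, rfl⟩
    rw [Pi.smul_apply, edgeVec_apply, if_neg he]
    simp

lemma isForest_insert {n : ℕ} {E : Type*} [DecidableEq E] (a b : E → Fin n) (e : E)
    (he : a e ≠ b e) (F : Finset E) (heF : e ∉ F) :
    IsForest a b (insert e F) ↔ IsForest (fun g => if a g = b e then a e else a g)
        (fun g => if b g = b e then a e else b g) F := by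
  have h1 : IsForest a b (insert e F) ↔ LinearIndepOn ℚ (edgeVec a b) ({e} ∪ (F : Set E)) := by
    rw [Set.singleton_union, ← Finset.coe_insert]
    exact Iff.rfl
  have h2 : edgeVec a b e ≠ 0 := by
    intro h
    have := congrFun h (a e)
    rw [edgeVec_apply, if_neg (Ne.symm he)] at this
    simp at this
  have h3 : IsForest (fun g => if a g = b e then a e else a g)
        (fun g => if b g = b e then a e else b g) F ↔
        LinearIndepOn ℚ (contr (edgeVec a b e) (b e) ∘ edgeVec a b) (F : Set E) := by
    have : (contr (edgeVec a b e) (b e) ∘ edgeVec a b) = edgeVec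
      (fun g => if a g = b e then a e else a g) (fun g => if b g = b e then a e else b g) := by
      funext f
      exact contr_edgeVec a b e f he
    rw [this]
    exact Iff.rfl
  rw [h1, h3, linearIndepOn_union_iff_quotient (by simpa using heF), Set.image_singleton,
    and_iff_right (by simpa using h2)]
  have hk := ker_contr a b e he
  have h4 : (contr (edgeVec a b e) (b e) ∘ edgeVec a b) =
    (Submodule.liftQ (Submodule.span ℚ {edgeVec a b e}) (contr (edgeVec a b e) (b e)) hk.ge) ∘
     ((Submodule.span ℚ {edgeVec a b e}).mkQ ∘ edgeVec a b) := by
    funext f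
    simp
  rw [h4]
  symm
  apply LinearMap.linearIndepOn_iff_of_injOn
  apply Function.Injective.injOn
  rw [← LinearMap.ker_eq_bot]
  exact Submodule.ker_liftQ_eq_bot _ _ _ hk.le

lemma subSums_insert {n : ℕ} {E : Type*} [DecidableEq E] (a b : E → Fin n) (T : Finset E) (e : E)
    (heT : e ∉ T) : subSums a b (insert e T) =
      subSums a b T ∪ (subSums a b T).image (· + edgeVec a b e) := by
  rw [subSums, Finset.powerset_insert, Finset.image_union]
  congr 1
  rw [subSums, Finset.image_image, Finset.image_image]
  apply Finset.image_congr
  intro S hS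
  have : e ∉ S := fun h => heT (Finset.mem_powerset.mp hS h)
  simp [Finset.sum_insert this, add_comm]

lemma forestsIn_insert {n : ℕ} {E : Type*} [DecidableEq E] (a b : E → Fin n) (T : Finset E)
    (e : E) (heT : e ∉ T) (he : a e ≠ b e) : (forestsIn a b (insert e T)).card =
      (forestsIn a b T).card + (forestsIn (fun g => if a g = b e then a e else a g)
        (fun g => if b g = b e then a e else b g) T).card := by
  classical
  rw [forestsIn, Finset.powerset_insert, Finset.filter_union, Finset.card_union_of_disjoint]
  · congr 1
    rw [Finset.filter_image, Finset.card_image_of_injOn]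
    · rw [forestsIn]
      congr 1
      apply Finset.filter_congr
      intro F hF
      exact isForest_insert a b e he F (fun h => heT (Finset.mem_powerset.mp hF h))
    · intro F hF F' hF' h
      have h1 : e ∉ F := fun h => heT (Finset.mem_powerset.mp (Finset.mem_filter.mp hF).1 h)
      have h2 : e ∉ F' := fun h => heT (Finset.mem_powerset.mp (Finset.mem_filter.mp hF').1 h)
      rw [← Finset.erase_insert h1, ← Finset.erase_insert h2]
      exact congrArg (fun s => Finset.erase s e) h
  · rw [Finset.disjoint_left]
    intro F hF hF'
    simp only [Finset.mem_filter, Finset.mem_powerset, Finset.mem_image] at hF hF'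
    obtain ⟨⟨G, _, rfl⟩, _⟩ := hF'
    exact heT (hF.1 (Finset.mem_insert_self _ _))

theorem card_subSums {n : ℕ} {E : Type*} [DecidableEq E] (T : Finset E) :
    ∀ (a b : E → Fin n), (subSums a b T).card = (forestsIn a b T).card := by
  classical
  induction T using Finset.induction_on with
  | empty =>
    intro a b
    have : IsForest a b ∅ := by
      unfold IsForest
      exact linearIndependent_empty_type
    simp [subSums, forestsIn, Finset.filter_singleton, this]
  | insert e T heT ih =>
    intro a b
    by_cases he : a e = b e
    · have h0 : edgeVec a b e = 0 := by
        ext i; simp [edgeVec_apply, he]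
      rw [subSums_insert a b T e heT, h0]
      simp only [add_zero, Finset.image_id', Finset.union_self]
      rw [ih a b]
      congr 1
      ext F
      simp only [forestsIn, Finset.mem_filter, Finset.mem_powerset]
      constructor
      · rintro ⟨h1, h2⟩
        exact ⟨h1.trans (Finset.subset_insert _ _), h2⟩
      · rintro ⟨h1, h2⟩
        refine ⟨?_, h2⟩
        intro x hx
        rcases Finset.mem_insert.mp (h1 hx) with rfl | h
        · exact absurd h0 (h2.ne_zero ⟨x, hx⟩)
        · exact h
    · rw [forestsIn_insert a b T e heT he, subSums_insert a b T e heT, ← ih, ← ih,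
        ← Finset.union_sdiff_self_eq_union, Finset.card_union_of_disjoint Finset.disjoint_sdiff]
      congr 1
      have himg : subSums (fun g => if a g = b e then a e else a g)
        (fun g => if b g = b e then a e else b g) T =
          (subSums a b T).image (contr (edgeVec a b e) (b e)) := by
        rw [subSums, subSums, Finset.image_image]
        apply Finset.image_congr
        intro S hS
        simp only [Function.comp, map_sum, contr_edgeVec a b e _ he]
      have hv0 : contr (edgeVec a b e) (b e) (edgeVec a b e) = 0 := by
        rw [← LinearMap.mem_ker, ker_contr a b e he]
        exact Submodule.mem_span_singleton_self _
      have hker : ∀ x y, contr (edgeVec a b e) (b e) x = contr (edgeVec a b e) (b e) y →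
          ∃ k : ℚ, y = x + k • edgeVec a b e := by
        intro x y h
        have : y - x ∈ LinearMap.ker (contr (edgeVec a b e) (b e)) := by
          rw [LinearMap.mem_ker, map_sub, h, sub_self]
        rw [ker_contr a b e he, Submodule.mem_span_singleton] at this
        obtain ⟨k, hk⟩ := this
        exact ⟨k, by rw [hk]; abel⟩
      rw [himg]
      have hset : (subSums a b T).image (contr (edgeVec a b e) (b e)) =
        ((subSums a b T).image (· + edgeVec a b e) \ subSums a b T).image
          (contr (edgeVec a b e) (b e)) := by
        ext y
        simp only [Finset.mem_image, Finset.mem_sdiff]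
        constructor
        · rintro ⟨z, hz, rfl⟩
          obtain ⟨w, hw, hmax⟩ := Finset.exists_max_image ((subSums a b T).filter
            (fun w => contr (edgeVec a b e) (b e) w = contr (edgeVec a b e) (b e) z))
            (fun w => w (a e)) ⟨z, by simp [hz]⟩
          rw [Finset.mem_filter] at hw
          refine ⟨w + edgeVec a b e, ⟨⟨w, hw.1, rfl⟩, ?_⟩, ?_⟩
          · intro hmem
            have := hmax (w + edgeVec a b e) (by
              rw [Finset.mem_filter]
              exact ⟨hmem, by rw [map_add, hv0, add_zero, hw.2]⟩)
            rw [Pi.add_apply, edgeVec_apply, if_neg (Ne.symm he)] at this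
            simp at this
            linarith
          · rw [map_add, hv0, add_zero, hw.2]
        · rintro ⟨z, ⟨⟨w, hw, rfl⟩, _⟩, rfl⟩
          exact ⟨w, hw, by rw [map_add, hv0, add_zero]⟩
      rw [hset, Finset.card_image_of_injOn]
      have main : ∀ w ∈ subSums a b T, ∀ k : ℚ, w + k • edgeVec a b e ∈ subSums a b T →
          w + edgeVec a b e ∉ subSums a b T → k ≤ 0 := by
        intro w hw k hk h
        by_contra! hpos
        exact h (subSums_step a b T e he w k hpos hw hk)
      intro x hx y hy hxy
      simp only [Finset.coe_sdiff, Finset.coe_image, Set.mem_sdiff, Set.mem_image,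
        Finset.mem_coe] at hx hy
      obtain ⟨⟨w, hw, rfl⟩, hx⟩ := hx
      obtain ⟨⟨w', hw', rfl⟩, hy⟩ := hy
      simp only [map_add, hv0, add_zero] at hxy
      obtain ⟨k, rfl⟩ := hker _ _ hxy
      have h1 := main w hw k hw' hx
      have h2 := main _ hw' (-k) (by simpa [neg_smul] using hw) hy
      have : k = 0 := by linarith
      simp [this]

open Classical in
lemma indicator_mem {K : Type*} [Field K] {α ι : Type*} (f : ι → α → K)
    (Y : Finset (ι → K)) (y : ι → K) :
    ∃ δ ∈ Algebra.adjoin K (Set.range f), ∀ s, (fun i => f i s) ∈ Y →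
      δ s = if (fun i => f i s) = y then 1 else 0 := by
  classical
  have h : ∀ y' : ι → K, ∃ δ ∈ Algebra.adjoin K (Set.range f),
      (∀ s, (fun i => f i s) = y → δ s = 1) ∧
      (∀ s, y' ≠ y → (fun i => f i s) = y' → δ s = 0) := by
    intro y'
    by_cases hy : y' = y
    · exact ⟨1, one_mem _, fun _ _ => rfl, fun _ h => absurd hy h⟩
    · obtain ⟨i, hi⟩ := Function.ne_iff.mp hy
      refine ⟨algebraMap K (α → K) (y i - y' i)⁻¹ * (f i - algebraMap K (α → K) (y' i)), ?_, ?_, ?_⟩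
      · exact mul_mem (Subalgebra.algebraMap_mem _ _)
          (sub_mem (Algebra.subset_adjoin ⟨i, rfl⟩) (Subalgebra.algebraMap_mem _ _))
      · intro s hs
        have h1 : f i s = y i := congrFun hs i
        have h2 : y i - y' i ≠ 0 := sub_ne_zero.mpr (Ne.symm hi)
        simp [h1, h2]
      · intro s _ hs
        have h1 : f i s = y' i := congrFun hs i
        simp [h1]
  choose δ hδ h1 h2 using h
  refine ⟨∏ y' ∈ Y, δ y', prod_mem fun y' _ => hδ y', ?_⟩
  intro s hs
  rw [Finset.prod_apply]
  split_ifs with hy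
  · exact Finset.prod_eq_one fun y' _ => h1 y' s hy
  · exact Finset.prod_eq_zero hs (h2 _ s hy rfl)

lemma finrank_adjoin_fun {K : Type*} [Field K] {α ι : Type*} [Finite α] (f : ι → α → K) :
    Module.finrank K (Algebra.adjoin K (Set.range f)) =
      Set.ncard (Set.range fun s => fun i => f i s) := by
  classical
  set F : α → ι → K := fun s i => f i s with hF
  have hfin : (Set.range F).Finite := Set.finite_range F
  have : Fintype (Set.range F) := hfin.fintype
  let L : (Set.range F → K) →ₗ[K] (α → K) := LinearMap.funLeft K K (Set.rangeFactorization F)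
  have hL : Function.Injective L :=
    LinearMap.funLeft_injective_of_surjective _ _ _ Set.rangeFactorization_surjective
  have hr : Subalgebra.toSubmodule (Algebra.adjoin K (Set.range f)) = LinearMap.range L := by
    apply le_antisymm
    · intro x hx
      rw [Subalgebra.mem_toSubmodule] at hx
      induction hx using Algebra.adjoin_induction with
      | mem x hx =>
        obtain ⟨i, rfl⟩ := hx
        exact ⟨fun y => y.1 i, rfl⟩
      | algebraMap r => exact ⟨fun _ => r, rfl⟩
      | add x y _ _ hx hy => exact add_mem hx hy
      | mul x y _ _ hx hy =>
        obtain ⟨g, rfl⟩ := hx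
        obtain ⟨g', rfl⟩ := hy
        exact ⟨g * g', rfl⟩
    · rintro _ ⟨g, rfl⟩
      rw [Subalgebra.mem_toSubmodule]
      choose δ hδ h1 using indicator_mem f hfin.toFinset
      have : L g = ∑ y : Set.range F, g y • δ y.1 := by
        funext s
        rw [Finset.sum_apply, Finset.sum_eq_single (⟨F s, s, rfl⟩ : Set.range F)]
        · rw [Pi.smul_apply, h1 _ s (by rw [Set.Finite.mem_toFinset]; exact ⟨s, rfl⟩), if_pos rfl]
          simp only [smul_eq_mul, mul_one]
          rfl
        · intro y _ hy
          rw [Pi.smul_apply, h1 _ s (by rw [Set.Finite.mem_toFinset]; exact ⟨s, rfl⟩), if_neg,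
            smul_zero]
          intro h
          exact hy (Subtype.ext h.symm)
        · simp
      rw [this]
      exact sum_mem fun y _ => Subalgebra.smul_mem _ (hδ _) _
  change Module.finrank K (Subalgebra.toSubmodule (Algebra.adjoin K (Set.range f))) = _
  rw [hr, LinearMap.finrank_range_of_inj hL, Module.finrank_fintype_fun_eq_card,
    ← Nat.card_eq_fintype_card, Nat.card_coe_set_eq]

open Classical in
/-- Evaluation of polynomials at the points of the grid. -/
def gridEval (K : Type*) [Field K] (E : Type*) (q : E → K) :
    MvPolynomial E K →ₐ[K] (Finset E → K) :=
  aeval fun e S => if e ∈ S then q e else 0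

open Classical in
lemma gridEval_apply (K : Type*) [Field K] (E : Type*) (q : E → K) (p : MvPolynomial E K)
    (S : Finset E) : gridEval K E q p S = eval (fun e => if e ∈ S then q e else 0) p := by
  have : (Pi.evalAlgHom K (fun _ : Finset E => K) S).comp (gridEval K E q) =
      aeval (fun e => if e ∈ S then q e else 0) := by
    apply MvPolynomial.algHom_ext
    intro e
    simp [gridEval]
  have h := DFunLike.congr_fun this p
  rw [MvPolynomial.aeval_eq_eval] at h
  exact h

lemma gridEval_rel (K : Type*) [Field K] (E : Type*) (q : E → K) :
    ∀ p ∈ relIdeal K E q, gridEval K E q p = 0 := by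
  intro p hp
  have : relIdeal K E q ≤ RingHom.ker (gridEval K E q) := by
    rw [relIdeal, Ideal.span_le]
    rintro _ ⟨e, rfl⟩
    rw [SetLike.mem_coe, RingHom.mem_ker]
    funext S
    rw [gridEval_apply]
    by_cases h : e ∈ S <;> simp [h, sq]
  exact this hp

lemma rel_of_gridEval (K : Type*) [Field K] (E : Type*) [Fintype E] (q : E → K)
    (hq : ∀ e, q e ≠ 0) (p : MvPolynomial E K) (hp : gridEval K E q p = 0) :
    p ∈ relIdeal K E q := by
  classical
  obtain ⟨h, -, hh⟩ := combinatorial_nullstellensatz_exists_linearCombination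
    (fun e => ({0, q e} : Finset K)) (fun e => ⟨0, by simp⟩) p (by
      intro x hx
      have := congrFun hp (Finset.univ.filter fun e => x e ≠ 0)
      rw [gridEval_apply] at this
      rw [Pi.zero_apply] at this
      rw [← this]
      congr 2
      funext e
      have := hx e
      simp only [Finset.mem_insert, Finset.mem_singleton] at this
      rcases this with h | h <;> simp [h, hq e])
  rw [hh, Finsupp.linearCombination_apply, Finsupp.sum]
  refine sum_mem fun e _ => ?_
  rw [smul_eq_mul]
  apply Ideal.mul_mem_left
  rw [Finset.prod_pair (Ne.symm (hq e))]
  apply Ideal.subset_span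
  refine ⟨e, ?_⟩
  simp only [map_zero, sub_zero]
  ring

/-- The evaluation on the quotient. -/
def phiEval (K : Type*) [Field K] (E : Type*) (q : E → K) :
    PhiAlg K E q →ₐ[K] (Finset E → K) :=
  Ideal.Quotient.liftₐ (relIdeal K E q) (gridEval K E q) (gridEval_rel K E q)

lemma phiEval_mk (K : Type*) [Field K] (E : Type*) (q : E → K) (p : MvPolynomial E K) :
    phiEval K E q (Ideal.Quotient.mk _ p) = gridEval K E q p := rfl

lemma phiEval_injective (K : Type*) [Field K] (E : Type*) [Fintype E] (q : E → K)
    (hq : ∀ e, q e ≠ 0) : Function.Injective (phiEval K E q) := by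
  rw [injective_iff_map_eq_zero]
  intro x hx
  obtain ⟨p, rfl⟩ := Ideal.Quotient.mk_surjective x
  rw [phiEval_mk] at hx
  exact Ideal.Quotient.eq_zero_iff_mem.mpr (rel_of_gridEval K E q hq p hx)

lemma phiEval_XX (K : Type*) [Field K] [CharZero K] {n : ℕ} {E : Type*} [Fintype E]
    (a b : E → Fin n) (q : E → K) (i : Fin n) (S : Finset E) :
    phiEval K E q (XX K a b q i) S = ∑ e ∈ S, q e * ((edgeVec a b e i : ℚ) : K) := by
  classical
  rw [XX, phiEval_mk, gridEval_apply, map_sub, map_sum, map_sum]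
  simp only [eval_X]
  rw [Finset.sum_filter, Finset.sum_filter, ← Finset.sum_sub_distrib,
    ← Finset.sum_subset (Finset.subset_univ S)]
  · apply Finset.sum_congr rfl
    intro e he
    rw [edgeVec_apply]
    push_cast
    simp only [he, if_true]
    split_ifs <;> simp
  · intro e _ he
    simp [he]

lemma finrank_Psi (K : Type*) [Field K] [CharZero K] {n : ℕ} {E : Type*} [Fintype E]
    (a b : E → Fin n) (q : E → K) (hq : ∀ e, q e ≠ 0) :
    Module.finrank K (PsiAlg K a b q) = Set.ncard (Set.range fun (S : Finset E) (i : Fin n) =>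
      ∑ e ∈ S, q e * ((edgeVec a b e i : ℚ) : K)) := by
  have h1 := ((PsiAlg K a b q).equivMapOfInjective (phiEval K E q)
    (phiEval_injective K E q hq)).toLinearEquiv.finrank_eq
  rw [h1, PsiAlg, AlgHom.map_adjoin, ← Set.range_comp, finrank_adjoin_fun]
  simp only [Function.comp, phiEval_XX]

lemma block_sum {K : Type*} [Field K] [CharZero K] {n : ℕ} {E : Type*} [Fintype E]
    (a b : E → Fin n) {m : ℕ} (π : E → Fin m) (c : Fin m → K) (S : Finset E) (i : Fin n) :
    ∑ e ∈ S, c (π e) * ((edgeVec a b e i : ℚ) : K) =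
      ∑ j, c j * (((∑ e ∈ S with π e = j, edgeVec a b e) i : ℚ) : K) := by
  classical
  rw [← Finset.sum_fiberwise S π]
  apply Finset.sum_congr rfl
  intro j _
  rw [Finset.sum_apply, Rat.cast_sum, Finset.mul_sum]
  apply Finset.sum_congr rfl
  intro e he
  rw [(Finset.mem_filter.mp he).2]

lemma range_ncard {K : Type*} [Field K] [CharZero K] {n : ℕ} {E : Type*} [Fintype E]
    [DecidableEq E] (a b : E → Fin n) {m : ℕ} (π : E → Fin m) (c : Fin m → K)
    (hc : LinearIndependent ℚ c) :
    Set.ncard (Set.range fun (S : Finset E) (i : Fin n) =>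
      ∑ e ∈ S, c (π e) * ((edgeVec a b e i : ℚ) : K)) =
      ∏ j : Fin m, (subSums a b (Finset.univ.filter fun e => π e = j)).card := by
  classical
  rw [← Fintype.card_piFinset, ← Set.ncard_coe_finset]
  symm
  apply Set.ncard_congr (fun z _ => fun i => ∑ j, c j * ((z j i : ℚ) : K))
  · intro z hz
    simp only [Finset.mem_coe, Fintype.mem_piFinset, mem_subSums] at hz
    choose S hS h using hz
    refine ⟨Finset.univ.filter fun e => e ∈ S (π e), ?_⟩
    funext i
    simp only
    rw [block_sum]
    apply Finset.sum_congr rfl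
    intro j _
    rw [← h j]
    suffices hs : (Finset.univ.filter fun e => e ∈ S (π e)).filter (fun e => π e = j) = S j by
      rw [hs]
    ext e
    simp only [Finset.mem_filter, Finset.mem_univ, true_and]
    constructor
    · rintro ⟨h1, rfl⟩; exact h1
    · intro h1
      have : π e = j := by simpa using hS j h1
      exact ⟨by rw [this]; exact h1, this⟩
  · intro z z' _ _ h
    funext j i
    have h1 := congrFun h i
    have h2 := (Fintype.linearIndependent_iff.mp hc) (fun j => z j i - z' j i) (by
      simp only [Rat.smul_def, Rat.cast_sub, sub_mul, Finset.sum_sub_distrib]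
      rw [sub_eq_zero]
      simpa only [mul_comm] using h1) j
    exact sub_eq_zero.mp h2
  · rintro _ ⟨S, rfl⟩
    refine ⟨fun j => ∑ e ∈ S with π e = j, edgeVec a b e, ?_, ?_⟩
    · simp only [Finset.mem_coe, Fintype.mem_piFinset, mem_subSums]
      intro j
      exact ⟨_, fun e he => by simpa using (Finset.mem_filter.mp he).2, rfl⟩
    · funext i
      simp only
      rw [block_sum]

/-- If the edges are partitioned into blocks by `π : E → Fin m` and the
block parameters `c` are algebraically independent over `ℚ` (generic), then the dimension
of `Ψ_{G,Q}` is the product over blocks of the number of forests contained in each block. -/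
theorem dim_generic_split
    {K : Type*} [Field K] [CharZero K] {n : ℕ} {E : Type*} [Fintype E] [DecidableEq E]
    (a b : E → Fin n) (hab : ∀ e, a e < b e) {m : ℕ} (π : E → Fin m) (c : Fin m → K)
    (hc : AlgebraicIndependent ℚ c) :
    Module.finrank K (PsiAlg K a b fun e => c (π e)) =
      ∏ i : Fin m, Set.ncard {F : Finset E | (∀ e ∈ F, π e = i) ∧ IsForest a b F} := by
  classical
  have hl := hc.linearIndependent
  rw [finrank_Psi K a b _ (fun e => hl.ne_zero (π e)), range_ncard a b π c hl]
  apply Finset.prod_congr rfl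
  intro i _
  rw [card_subSums, ← Set.ncard_coe_finset]
  congr 1
  ext F
  simp [forestsIn, Finset.subset_iff]

end
end

section
/- Let G be a connected loopless weighted graph (q_e ≠ 0 for every edge e) with a chosen root vertex g. Then dim_K Ψ^T_{G,Q} equals the number of distinct g-connected score vectors, i.e., the cardinality of { D ∈ K^n : there exists a g-connected orientation o of G with D = D_o }. -/
open MvPolynomial

set_option synthInstance.maxHeartbeats 1000000
set_option maxHeartbeats 1000000

noncomputable section

/-- The head of edge `e` under orientation `o`. -/
def head {n : ℕ} {E : Type*} (a b : E → Fin n) (o : E → Bool) (e : E) : Fin n :=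
  if o e then a e else b e

/-- The tail of edge `e` under orientation `o`. -/
def tail {n : ℕ} {E : Type*} (a b : E → Fin n) (o : E → Bool) (e : E) : Fin n :=
  if o e then b e else a e

/-- The score vector of an orientation. -/
def score (K : Type*) [Field K] {n : ℕ} {E : Type*} [Fintype E]
    (a b : E → Fin n) (q : E → K) (o : E → Bool) (i : Fin n) : K :=
  ∑ e ∈ Finset.univ.filter fun e => head a b o e = i, q e

/-- The edges of the cut oriented out of `I` (small endpoint in `I`). -/
def cutOut {n : ℕ} {E : Type*} [Fintype E] (a b : E → Fin n) (I : Finset (Fin n)) :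
    Finset E :=
  Finset.univ.filter fun e => a e ∈ I ∧ b e ∉ I

/-- The edges of the cut oriented into `I` (large endpoint in `I`). -/
def cutIn {n : ℕ} {E : Type*} [Fintype E] (a b : E → Fin n) (I : Finset (Fin n)) :
    Finset E :=
  Finset.univ.filter fun e => b e ∈ I ∧ a e ∉ I

/-- The cut polynomial `f_I`. -/
def fI {K : Type*} [Field K] {n : ℕ} {E : Type*} [Fintype E]
    (a b : E → Fin n) (q : E → K) (I : Finset (Fin n)) : MvPolynomial E K :=
  (∏ e ∈ cutOut a b I, X e) * ∏ e ∈ cutIn a b I, (X e - C (q e))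

/-- The graph `G` is connected. -/
def IsConnectedGraph {n : ℕ} {E : Type*} (a b : E → Fin n) : Prop :=
  ∀ x y : Fin n,
    Relation.ReflTransGen (fun u w => ∃ e, (a e = u ∧ b e = w) ∨ (a e = w ∧ b e = u)) x y

/-- The ideal of relations of `Φ^T_{G,Q}`: the relations `u_e^2 = q_e u_e` together with
the cut relations `f_I = 0` for proper subsets `I` containing the root `g`. -/
def relIdealT (K : Type*) [Field K] {n : ℕ} (E : Type*) [Fintype E]
    (a b : E → Fin n) (q : E → K) (g : Fin n) : Ideal (MvPolynomial E K) :=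
  Ideal.span ((Set.range fun e : E => (X e) ^ 2 - C (q e) * X e) ∪
    {p | ∃ I : Finset (Fin n), g ∈ I ∧ I ≠ Finset.univ ∧ p = fI a b q I})

/-- The algebra `Φ^T_{G,Q}`. -/
abbrev PhiT (K : Type*) [Field K] {n : ℕ} (E : Type*) [Fintype E]
    (a b : E → Fin n) (q : E → K) (g : Fin n) : Type _ :=
  MvPolynomial E K ⧸ relIdealT K E a b q g

/-- The generator `X_i^T`. -/
def XT (K : Type*) [Field K] {n : ℕ} {E : Type*} [Fintype E]
    (a b : E → Fin n) (q : E → K) (g : Fin n) (i : Fin n) : PhiT K E a b q g :=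
  Ideal.Quotient.mk _
    ((∑ e ∈ Finset.univ.filter fun e => a e = i, X e) -
      ∑ e ∈ Finset.univ.filter fun e => b e = i, X e)

/-- The `Q`-deformation `Ψ^T_{G,Q}` of the algebra counting spanning trees. -/
def PsiT (K : Type*) [Field K] {n : ℕ} {E : Type*} [Fintype E]
    (a b : E → Fin n) (q : E → K) (g : Fin n) : Subalgebra K (PhiT K E a b q g) :=
  Algebra.adjoin K (Set.range (XT K a b q g))

/-- The point of `K^E` attached to an orientation. -/
def ptOf {K : Type*} [Field K] {E : Type*} (q : E → K) (o : E → Bool) (e : E) : K :=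
  if o e then 0 else q e

/-- `g`-connectedness of an orientation. -/
def GConn {n : ℕ} {E : Type*} (a b : E → Fin n) (g : Fin n) (o : E → Bool) : Prop :=
  ∀ v : Fin n, Relation.ReflTransGen
    (fun u w => ∃ e, tail a b o e = u ∧ head a b o e = w) v g

theorem eval_fI {K : Type*} [Field K] {n : ℕ} {E : Type*} [Fintype E]
    (a b : E → Fin n) (q : E → K) (I : Finset (Fin n)) (x : E → K) :
    eval x (fI a b q I) = (∏ e ∈ cutOut a b I, x e) * ∏ e ∈ cutIn a b I, (x e - q e) := by
  simp [fI, eval_prod]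

/-- On a `g`-connected orientation all cut polynomials vanish. -/
theorem eval_fI_of_gconn {K : Type*} [Field K] {n : ℕ} {E : Type*} [Fintype E]
    (a b : E → Fin n) (q : E → K) (g : Fin n) (o : E → Bool) (ho : GConn a b g o)
    (I : Finset (Fin n)) (hg : g ∈ I) (hI : I ≠ Finset.univ) :
    eval (ptOf q o) (fI a b q I) = 0 := by
  rw [eval_fI]
  by_contra hne
  rw [← ne_eq, mul_ne_zero_iff, Finset.prod_ne_zero_iff, Finset.prod_ne_zero_iff] at hne
  obtain ⟨h1, h2⟩ := hne
  apply hI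
  rw [Finset.eq_univ_iff_forall]
  intro v
  induction ho v using Relation.ReflTransGen.head_induction_on with
  | refl => exact hg
  | head hstep _ ih =>
    obtain ⟨e, rfl, rfl⟩ := hstep
    by_contra hv
    by_cases hoe : o e = true
    · have := h1 e (by simp_all [cutOut, head, tail])
      simp [ptOf, hoe] at this
    · have := h2 e (by simp_all [cutIn, head, tail])
      simp [ptOf, hoe] at this

/-- On an orientation that is not `g`-connected some cut polynomial does not vanish. -/
theorem exists_fI_of_not_gconn {K : Type*} [Field K] {n : ℕ} {E : Type*} [Fintype E]
    (a b : E → Fin n) (q : E → K) (hq : ∀ e, q e ≠ 0)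
    (g : Fin n) (o : E → Bool) (ho : ¬ GConn a b g o) :
    ∃ I : Finset (Fin n), g ∈ I ∧ I ≠ Finset.univ ∧ eval (ptOf q o) (fI a b q I) ≠ 0 := by
  classical
  refine ⟨Finset.univ.filter fun v => Relation.ReflTransGen
    (fun u w => ∃ e, tail a b o e = u ∧ head a b o e = w) v g, ?_, ?_, ?_⟩
  · simpa using Relation.ReflTransGen.refl
  · intro h
    apply ho
    intro v
    have := Finset.mem_univ v
    rw [← h] at this
    simpa using this
  · rw [eval_fI, mul_ne_zero_iff, Finset.prod_ne_zero_iff, Finset.prod_ne_zero_iff]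
    constructor
    · intro e he
      simp only [cutOut, Finset.mem_filter, Finset.mem_univ, true_and] at he
      by_cases hoe : o e = true
      · exact absurd (Relation.ReflTransGen.head ⟨e, by simp [tail, hoe], by simp [head, hoe]⟩ he.1)
          he.2
      · simp [ptOf, hoe, hq]
    · intro e he
      simp only [cutIn, Finset.mem_filter, Finset.mem_univ, true_and] at he
      by_cases hoe : o e = true
      · simp [ptOf, hoe, hq]
      · exact absurd (Relation.ReflTransGen.head ⟨e, by simp [tail, hoe], by simp [head, hoe]⟩ he.1)
          he.2

/-- Lagrange idempotents. -/
def lagr {K : Type*} [Field K] {E : Type*} [Fintype E] (q : E → K) (o : E → Bool) :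
    MvPolynomial E K :=
  ∏ e, if o e then 1 - C (q e)⁻¹ * X e else C (q e)⁻¹ * X e

theorem sum_lagr {K : Type*} [Field K] {E : Type*} [Fintype E] [DecidableEq E] (q : E → K) :
    ∑ o : E → Bool, lagr q o = 1 := by
  have h := Finset.prod_univ_sum (fun _ : E => (Finset.univ : Finset Bool))
    (fun e (t : Bool) => if t then 1 - C (q e)⁻¹ * X e else C (q e)⁻¹ * (X e : MvPolynomial E K))
  simp only [Fintype.piFinset_univ] at h
  unfold lagr
  rw [← h]
  simp

theorem mul_lagr_mem {K : Type*} [Field K] {n : ℕ} {E : Type*} [Fintype E] [DecidableEq E]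
    (a b : E → Fin n) (q : E → K) (hq : ∀ e, q e ≠ 0) (g : Fin n) (o : E → Bool)
    (f : MvPolynomial E K) :
    f * lagr q o - C (eval (ptOf q o) f) * lagr q o ∈ relIdealT K E a b q g := by
  induction f using MvPolynomial.induction_on with
  | C r => simp
  | add f₁ f₂ h1 h2 =>
    have := Ideal.add_mem _ h1 h2
    convert this using 1
    simp only [map_add]
    ring
  | mul_X f e h =>
    have hX : X e * lagr q o - C (ptOf q o e) * lagr q o ∈ relIdealT K E a b q g := by
      have hgen : (X e) ^ 2 - C (q e) * X e ∈ relIdealT K E a b q g :=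
        Ideal.subset_span (Or.inl ⟨e, rfl⟩)
      have hc : (C (q e)⁻¹ * C (q e) : MvPolynomial E K) = 1 := by
        rw [← C_mul, inv_mul_cancel₀ (hq e), C_1]
      unfold lagr
      rw [← Finset.mul_prod_erase Finset.univ _ (Finset.mem_univ e)]
      generalize (∏ x ∈ Finset.univ.erase e,
        if o x = true then 1 - C (q x)⁻¹ * X x else C (q x)⁻¹ * (X x : MvPolynomial E K)) = R
      by_cases hoe : o e = true
      · have := Ideal.mul_mem_left _ (-(C (q e)⁻¹) * R) hgen
        convert this using 1
        simp only [hoe, ptOf, if_true, C_0]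
        linear_combination (-(X e * R)) * hc
      · have := Ideal.mul_mem_left _ ((C (q e)⁻¹) * R) hgen
        convert this using 1
        simp only [hoe, ptOf]
        simp
        ring
    have := Ideal.add_mem _ (Ideal.mul_mem_left _ (X e) h)
      (Ideal.mul_mem_left _ (C (eval (ptOf q o) f)) hX)
    convert this using 1
    simp only [map_mul, eval_X]
    ring

theorem mem_relIdealT_iff {K : Type*} [Field K] {n : ℕ} {E : Type*} [Fintype E] [DecidableEq E]
    (a b : E → Fin n) (q : E → K) (hq : ∀ e, q e ≠ 0) (g : Fin n) (f : MvPolynomial E K) :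
    f ∈ relIdealT K E a b q g ↔ ∀ o : E → Bool, GConn a b g o → eval (ptOf q o) f = 0 := by
  constructor
  · intro hf o ho
    have hle : relIdealT K E a b q g ≤ RingHom.ker (eval (ptOf q o)) := by
      unfold relIdealT
      rw [Ideal.span_le]
      rintro p (⟨e, rfl⟩ | ⟨I, hg, hI, rfl⟩)
      · simp only [SetLike.mem_coe, RingHom.mem_ker]
        by_cases hoe : o e = true
        · simp [ptOf, hoe]
        · simp [ptOf, hoe, sq]
      · exact eval_fI_of_gconn a b q g o ho I hg hI
    exact hle hf
  · intro hf
    have h1 : f = ∑ o : E → Bool, f * lagr q o := by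
      rw [← Finset.mul_sum, sum_lagr, mul_one]
    rw [h1]
    refine Ideal.sum_mem _ fun o _ => ?_
    by_cases ho : GConn a b g o
    · have := mul_lagr_mem a b q hq g o f
      rw [hf o ho] at this
      simpa using this
    · obtain ⟨I, hg, hI, hne⟩ := exists_fI_of_not_gconn a b q hq g o ho
      have h2 := mul_lagr_mem a b q hq g o (fI a b q I)
      have h3 : fI a b q I ∈ relIdealT K E a b q g := Ideal.subset_span (Or.inr ⟨I, hg, hI, rfl⟩)
      have h4 := Ideal.sub_mem _ (Ideal.mul_mem_right (lagr q o) _ h3) h2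
      have h5 := Ideal.mul_mem_left _ (f * C (eval (ptOf q o) (fI a b q I))⁻¹) h4
      convert h5 using 1
      have hc : (C (eval (ptOf q o) (fI a b q I))⁻¹ * C (eval (ptOf q o) (fI a b q I)) :
          MvPolynomial E K) = 1 := by
        rw [← C_mul, inv_mul_cancel₀ hne, C_1]
      linear_combination (-(f * lagr q o)) * hc

/-- The polynomial lift of `X_i^T`. -/
def XTpoly (K : Type*) [Field K] {n : ℕ} {E : Type*} [Fintype E]
    (a b : E → Fin n) (i : Fin n) : MvPolynomial E K :=
  (∑ e ∈ Finset.univ.filter fun e => a e = i, X e) -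
      ∑ e ∈ Finset.univ.filter fun e => b e = i, X e

theorem eval_XTpoly {K : Type*} [Field K] {n : ℕ} {E : Type*} [Fintype E]
    (a b : E → Fin n) (hab : ∀ e, a e < b e) (q : E → K) (o : E → Bool) (i : Fin n) :
    eval (ptOf q o) (XTpoly K a b i) =
      (∑ e ∈ Finset.univ.filter fun e => a e = i, q e) - score K a b q o i := by
  simp only [XTpoly, score, map_sub, map_sum, eval_X]
  simp only [Finset.sum_filter]
  rw [← Finset.sum_sub_distrib, ← Finset.sum_sub_distrib]
  refine Finset.sum_congr rfl fun e _ => ?_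
  have := hab e
  by_cases hoe : o e = true
  · simp [ptOf, head, hoe]
  · simp only [ptOf, head, hoe]
    by_cases h1 : a e = i <;> by_cases h2 : b e = i <;> simp [h1, h2]

/-- Interpolation at finitely many points. -/
theorem interp {K : Type*} [Field K] {σ : Type*} {ι : Type*} [Fintype ι] [DecidableEq ι]
    (p : ι → σ → K) (hp : Function.Injective p) (t : ι → K) :
    ∃ P : MvPolynomial σ K, ∀ i, eval (p i) P = t i := by
  have h1 : ∀ i j, ∃ P : MvPolynomial σ K, i ≠ j → eval (p i) P = 1 ∧ eval (p j) P = 0 := by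
    intro i j
    by_cases hij : i = j
    · exact ⟨0, fun h => absurd hij h⟩
    · obtain ⟨s, hs⟩ := Function.ne_iff.mp (hp.ne hij)
      refine ⟨C (p i s - p j s)⁻¹ * (X s - C (p j s)), fun _ => ⟨?_, ?_⟩⟩
      · simp [inv_mul_cancel₀ (sub_ne_zero.mpr hs)]
      · simp
  choose P hP using h1
  refine ⟨∑ i, C (t i) * ∏ j ∈ Finset.univ.erase i, P i j, fun k => ?_⟩
  rw [map_sum, Finset.sum_eq_single k]
  · rw [map_mul, eval_C, eval_prod, Finset.prod_eq_one, mul_one]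
    intro j hj
    exact (hP k j (Finset.ne_of_mem_erase hj).symm).1
  · intro i _ hik
    rw [map_mul, eval_prod, Finset.prod_eq_zero (i := k), mul_zero]
    · simp [Ne.symm hik]
    · exact (hP i k hik).2
  · simp

/-- For a connected loopless weighted graph with root `g`, the dimension of
`Ψ^T_{G,Q}` equals the number of distinct `g`-connected score vectors. -/
theorem dim_PsiT_eq_card_rooted_score_vectors
    {K : Type*} [Field K] [CharZero K] {n : ℕ} {E : Type*} [Fintype E] [DecidableEq E]
    (a b : E → Fin n) (q : E → K) (g : Fin n)
    (hab : ∀ e, a e < b e) (hq : ∀ e, q e ≠ 0) (hconn : IsConnectedGraph a b) :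
    Module.finrank K (PsiT K a b q g) =
      Set.ncard {D : Fin n → K | ∃ o : E → Bool,
        (∀ v : Fin n, Relation.ReflTransGen
          (fun u w => ∃ e, tail a b o e = u ∧ head a b o e = w) v g) ∧
        D = score K a b q o} := by
  classical
  set S : Set (Fin n → K) := {D : Fin n → K | ∃ o : E → Bool,
        (∀ v : Fin n, Relation.ReflTransGen
          (fun u w => ∃ e, tail a b o e = u ∧ head a b o e = w) v g) ∧
        D = score K a b q o} with hS
  have hfin : S.Finite := by
    refine (Set.finite_range (score K a b q)).subset ?_
    rintro D ⟨o, _, rfl⟩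
    exact ⟨o, rfl⟩
  haveI : Fintype S := hfin.fintype
  let c : Fin n → K := fun i => ∑ e ∈ Finset.univ.filter fun e => a e = i, q e
  let A : MvPolynomial (Fin n) K →ₐ[K] PhiT K E a b q g := aeval (XT K a b q g)
  let B : MvPolynomial (Fin n) K →ₗ[K] (S → K) :=
    LinearMap.pi fun d => (aeval (R := K) (c - d.1)).toLinearMap
  have hBapp : ∀ P d, B P d = eval (c - d.1) P := by
    intro P d
    simp [B, LinearMap.pi_apply, coe_aeval_eq_eval]
  have hBsurj : LinearMap.range B = ⊤ := by
    rw [LinearMap.range_eq_top]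
    intro t
    obtain ⟨P, hP⟩ := interp (fun d : S => c - d.1)
      (fun d d' h => Subtype.ext (sub_right_injective h)) t
    exact ⟨P, funext fun d => by rw [hBapp, hP]⟩
  have hA : ∀ P, A P = Ideal.Quotient.mk _ (aeval (XTpoly K a b) P) := by
    intro P
    have : A = (Ideal.Quotient.mkₐ K (relIdealT K E a b q g)).comp (aeval (XTpoly K a b)) := by
      apply MvPolynomial.algHom_ext
      intro i
      simp [A, XT, XTpoly]
    rw [this]
    rfl
  have hker : LinearMap.ker A.toLinearMap = LinearMap.ker B := by
    ext P
    rw [LinearMap.mem_ker, LinearMap.mem_ker, AlgHom.toLinearMap_apply, hA,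
      Ideal.Quotient.eq_zero_iff_mem, mem_relIdealT_iff a b q hq g]
    have key : ∀ o, eval (ptOf q o) (aeval (XTpoly K a b) P) = eval (c - score K a b q o) P := by
      intro o
      have h1 : (aeval (R := K) (ptOf q o)).comp (aeval (XTpoly K a b)) =
          aeval (R := K) (c - score K a b q o) := by
        apply MvPolynomial.algHom_ext
        intro i
        simp only [AlgHom.comp_apply, aeval_X]
        change eval (ptOf q o) (XTpoly K a b i) = _
        exact eval_XTpoly a b hab q o i
      have h2 := DFunLike.congr_fun h1 P
      simpa [coe_aeval_eq_eval] using h2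
    constructor
    · intro h
      funext d
      obtain ⟨_, o, ho, rfl⟩ := d
      rw [hBapp, ← key]
      exact h o ho
    · intro h o ho
      rw [key]
      have := congrFun h ⟨score K a b q o, o, ho, rfl⟩
      rwa [hBapp] at this
  have hPsi : PsiT K a b q g = A.range := Algebra.adjoin_range_eq_range_aeval K _
  have h1 : Module.finrank K (PsiT K a b q g) = Module.finrank K (LinearMap.range A.toLinearMap) := by
    rw [hPsi]
    rfl
  rw [h1, ← LinearEquiv.finrank_eq A.toLinearMap.quotKerEquivRange, hker,
    LinearEquiv.finrank_eq B.quotKerEquivRange, hBsurj, finrank_top, Module.finrank_fintype_fun_eq_card,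
    Set.ncard_eq_toFinset_card', Set.toFinset_card]

end
end
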